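/- No ternary cubic form of Waring rank 2 is the Hessian of a ternary cubic form: there is no ternary cubic form g over ℂ such that rank(Hess(g)) = 2. -/

import Mathlib

open MvPolynomial

/-- Ternary forms: polynomials in three variables over `ℂ`. -/
abbrev Ternary : Type := MvPolynomial (Fin 3) ℂ

/-- A linear form is a homogeneous polynomial of degree 1. -/
def IsLinearForm (a : Ternary) : Prop := MvPolynomial.IsHomogeneous a 1

/-- The Waring rank of a form `f` (with respect to degree `d`): the least `r`
such that `f` is a sum of `r` `d`-th powers of linear forms. -/
noncomputable def waringRank (d : ℕ) (f : Ternary) : ℕ :=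
  sInf {r : ℕ | ∃ l : Fin r → Ternary, (∀ i, IsLinearForm (l i)) ∧ f = ∑ i, (l i) ^ d}

/-- The Hessian determinant of a ternary form: the determinant of the matrix of
second partial derivatives. -/
noncomputable def hess (f : Ternary) : Ternary :=
  Matrix.det (Matrix.of fun i j : Fin 3 =>
    MvPolynomial.pderiv i (MvPolynomial.pderiv j f))

/-- `[abc]`: the determinant of the 3×3 matrix whose rows are the coefficients of
the linear forms `a`, `b`, `c`. -/
noncomputable def bracket (a b c : Ternary) : ℂ :=
  Matrix.det (Matrix.of
    ![![MvPolynomial.coeff (Finsupp.single 0 1) a, MvPolynomial.coeff (Finsupp.single 1 1) a,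
        MvPolynomial.coeff (Finsupp.single 2 1) a],
      ![MvPolynomial.coeff (Finsupp.single 0 1) b, MvPolynomial.coeff (Finsupp.single 1 1) b,
        MvPolynomial.coeff (Finsupp.single 2 1) b],
      ![MvPolynomial.coeff (Finsupp.single 0 1) c, MvPolynomial.coeff (Finsupp.single 1 1) c,
        MvPolynomial.coeff (Finsupp.single 2 1) c]])

/-- A determinantal representation `det (x • T₀ + y • T₁ + z • T₂)` by the slices of a symmetric
`3 × 3 × 3` tensor is never a nonzero multiple of `x ^ 3 + y ^ 3`. -/
theorem det_symmetric_tensor_ne_sum_two_cubes (s : Fin 3 → Fin 3 → Fin 3 → ℂ)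
    (hs : ∀ i j k, s i j k = s j i k) (hs' : ∀ i j k, s i j k = s i k j) {w : ℂ} (hw : w ≠ 0)
    (H : ∀ v : Fin 3 → ℂ,
      (Matrix.of fun i j => ∑ k, v k * s k i j).det = w * (v 0 ^ 3 + v 1 ^ 3)) : False := by
  have key (x y z : ℂ) := H ![x, y, z]
  simp only [Matrix.det_fin_three, Matrix.of_apply, Fin.sum_univ_three, Matrix.cons_val_zero,
    Matrix.cons_val_one, Matrix.cons_val] at key
  rw [hs 1 0 0, hs 2 0 0, hs 1 0 1, hs 1 0 2, hs 2 0 1, hs 2 0 2, hs 2 1 0, hs 2 1 1, hs 2 1 2,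
    hs' 0 1 0, hs' 0 2 0, hs' 0 2 1, hs' 1 1 0, hs' 1 2 0, hs' 1 2 1, hs 1 0 1, hs 1 0 2,
    hs' 2 2 0, hs' 2 2 1, hs 2 0 2, hs 2 1 2] at key
  generalize s 0 0 0 = a, s 0 0 1 = b, s 0 0 2 = c, s 0 1 1 = d, s 0 1 2 = e, s 0 2 2 = f,
    s 1 1 1 = h, s 1 1 2 = i, s 1 2 2 = j, s 2 2 2 = k at key
  have h₁ := key 1 0 0
  have h₂ := key 0 1 0
  have h₃ := key 0 0 1
  have h₄ := key 1 1 0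
  have h₅ := key 1 (-1) 0
  have h₆ := key 1 0 1
  have h₇ := key 1 0 (-1)
  have h₈ := key 0 1 1
  have h₉ := key 0 1 (-1)
  have h₁₀ := key 1 1 1
  clear key H hs hs'
  grind

/-- The evaluation of a linear form is the dot product with its gradient. -/
theorem eval_linearForm {p : Ternary} (hp : IsLinearForm p) (v : Fin 3 → ℂ) :
    eval v p = ∑ k, v k * constantCoeff (pderiv k p) := by
  have h := congrArg (eval v) (IsHomogeneous.sum_X_mul_pderiv hp)
  rw [one_smul, map_sum] at h
  rw [← h]
  refine Finset.sum_congr rfl fun k _ => ?_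
  have h0 : (pderiv k p).totalDegree = 0 :=
    Nat.le_zero.mp <| IsHomogeneous.totalDegree_le (IsHomogeneous.pderiv hp)
  rw [totalDegree_eq_zero_iff_eq_C.mp h0]
  simp

theorem pderiv_comm (i j : Fin 3) (p : Ternary) :
    pderiv i (pderiv j p) = pderiv j (pderiv i p) := by
  have h : ⁅(pderiv i : Derivation ℂ Ternary Ternary),
      (pderiv j : Derivation ℂ Ternary Ternary)⁆ = 0 := by
    refine derivation_ext fun k => ?_
    rw [Derivation.commutator_apply]
    simp [pderiv_X, Pi.single_apply, apply_ite]
  have hD := congrArg (fun D : Derivation ℂ Ternary Ternary => D p) h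
  simpa [Derivation.commutator_apply, sub_eq_zero] using hD

/-- Two linearly independent vectors are the first two rows of an invertible matrix. -/
theorem exists_det_ne_zero {p q : Fin 3 → ℂ} (h : LinearIndependent ℂ ![p, q]) :
    ∃ r : Fin 3 → ℂ, (Matrix.of ![p, q, r]).det ≠ 0 := by
  obtain ⟨i, hi⟩ := Function.ne_iff.mp (crossProduct_ne_zero_iff_linearIndependent.mpr h)
  refine ⟨Pi.single i 1, ?_⟩
  have h' : (Matrix.of ![p, q, Pi.single i 1]).det =
      Pi.single i 1 ⬝ᵥ (crossProduct p q) := by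
    rw [triple_product_permutation, triple_product_eq_det]
    rfl
  rw [h', single_one_dotProduct]
  exact hi

theorem exists_cube_eq_sum_of_mul {a b : Ternary} {c : ℂ} (ha : IsLinearForm a)
    (hb : b = C c * a) : ∃ l : Ternary, IsLinearForm l ∧ a ^ 3 + b ^ 3 = l ^ 3 := by
  obtain ⟨d, hd⟩ := IsAlgClosed.exists_pow_nat_eq (1 + c ^ 3) (n := 3) (by norm_num)
  refine ⟨C d * a, ha.C_mul d, ?_⟩
  rw [hb, mul_pow, mul_pow, ← map_pow, ← map_pow, hd, map_add, map_one]
  ring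

/-- The gradients of two linear forms whose cubes do not sum to a cube are independent. -/
theorem linearIndependent_of_sum_ne_cube {a b : Ternary} (ha : IsLinearForm a)
    (hb : IsLinearForm b) (h : ∀ l, IsLinearForm l → a ^ 3 + b ^ 3 ≠ l ^ 3) :
    LinearIndependent ℂ ![fun k => constantCoeff (pderiv k a),
      fun k => constantCoeff (pderiv k b)] := by
  have ha0 : (fun k => constantCoeff (pderiv k a)) ≠ 0 := by
    intro h0
    have : a = 0 := funext fun v => by
      rw [eval_linearForm ha, map_zero]
      exact Finset.sum_eq_zero fun k _ => by simp [congrFun h0 k]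
    exact h b hb (by simp [this])
  rw [LinearIndependent.pair_iff' ha0]
  intro c hc
  have hbc : b = C c * a := funext fun v => by
    rw [map_mul, eval_C, eval_linearForm ha, eval_linearForm hb, Finset.mul_sum]
    refine Finset.sum_congr rfl fun k _ => ?_
    rw [← congrFun hc k, Pi.smul_apply, smul_eq_mul]
    ring
  obtain ⟨l, hl, e⟩ := exists_cube_eq_sum_of_mul ha hbc
  exact h l hl e

/-- A form of Waring rank two is a sum of two cubes of linear forms, and not a single cube. -/
theorem exists_of_waringRank_eq_two {f : Ternary} (hf : waringRank 3 f = 2) :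
    ∃ a b : Ternary, IsLinearForm a ∧ IsLinearForm b ∧ f = a ^ 3 + b ^ 3 ∧
      ∀ l, IsLinearForm l → f ≠ l ^ 3 := by
  have hmem := Nat.sInf_mem (Nat.nonempty_of_pos_sInf (hf ▸ two_pos : 0 < waringRank 3 f))
  change waringRank 3 f ∈ _ at hmem
  rw [hf] at hmem
  obtain ⟨l, hl, e⟩ := hmem
  refine ⟨l 0, l 1, hl 0, hl 1, by rw [e, Fin.sum_univ_two], fun m hm e' => ?_⟩
  have : waringRank 3 f ≤ 1 := Nat.sInf_le ⟨fun _ => m, fun _ => hm, by simp [e']⟩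
  omega

/-- The Hessian of a cubic at `v`, as a contraction of the tensor of its third derivatives. -/
theorem eval_hess {g : Ternary} (hg : g.IsHomogeneous 3) (v : Fin 3 → ℂ) :
    eval v (hess g) = (Matrix.of fun i j =>
      ∑ k, v k * constantCoeff (pderiv k (pderiv i (pderiv j g)))).det := by
  rw [hess, RingHom.map_det]
  congr 1
  ext i j
  exact eval_linearForm (hg.pderiv.pderiv) v

/-- A linear change of coordinates in the determinant of the slices of a tensor. -/
theorem det_tensor_change_of_basis (t : Fin 3 → Fin 3 → Fin 3 → ℂ) (A : Matrix (Fin 3) (Fin 3) ℂ)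
    (v : Fin 3 → ℂ) :
    (Matrix.of fun i j => ∑ k, v k * ∑ a, ∑ b, ∑ c, A a k * A b i * A c j * t a b c).det =
      A.det ^ 2 * (Matrix.of fun b c => ∑ a, (A.mulVec v) a * t a b c).det := by
  have h : (Matrix.of fun i j => ∑ k, v k * ∑ a, ∑ b, ∑ c, A a k * A b i * A c j * t a b c) =
      A.transpose * (Matrix.of fun b c => ∑ a, (A.mulVec v) a * t a b c) * A := by
    ext i j
    simp only [Matrix.mul_apply, Matrix.transpose_apply, Matrix.of_apply, Matrix.mulVec,
      dotProduct, Fin.sum_univ_three]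
    ring
  rw [h, Matrix.det_mul, Matrix.det_mul, Matrix.det_transpose]
  ring

/-- No ternary cubic form of Waring rank 2 is the Hessian of a ternary cubic form. -/
theorem no_rank_two_hessian :
    ¬ ∃ g : Ternary, MvPolynomial.IsHomogeneous g 3 ∧ waringRank 3 (hess g) = 2 := by
  rintro ⟨g, hg, hrank⟩
  obtain ⟨p, q, hp, hq, hf, hne⟩ := exists_of_waringRank_eq_two hrank
  obtain ⟨r, hr⟩ := exists_det_ne_zero
    (linearIndependent_of_sum_ne_cube hp hq fun l hl => hf ▸ hne l hl)
  let B : Matrix (Fin 3) (Fin 3) ℂ := Matrix.of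
    ![fun k => constantCoeff (pderiv k p), fun k => constantCoeff (pderiv k q), r]
  have hBA : B * B⁻¹ = 1 := Matrix.mul_nonsing_inv B hr.isUnit
  have hA : B⁻¹.det ^ 2 ≠ 0 := by
    refine pow_ne_zero 2 fun h0 => ?_
    simpa [h0] using congrArg Matrix.det hBA
  have hBv (v : Fin 3 → ℂ) : B.mulVec (B⁻¹.mulVec v) = v := by
    rw [Matrix.mulVec_mulVec, hBA, Matrix.one_mulVec]
  have hpv (v : Fin 3 → ℂ) : eval (B⁻¹.mulVec v) p = v 0 := by
    rw [eval_linearForm hp]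
    exact (Finset.sum_congr rfl fun k _ => mul_comm _ _).trans (congrFun (hBv v) 0)
  have hqv (v : Fin 3 → ℂ) : eval (B⁻¹.mulVec v) q = v 1 := by
    rw [eval_linearForm hq]
    exact (Finset.sum_congr rfl fun k _ => mul_comm _ _).trans (congrFun (hBv v) 1)
  let t (a b c : Fin 3) : ℂ := constantCoeff (pderiv a (pderiv b (pderiv c g)))
  have ht (a b c : Fin 3) : t a b c = t b a c := congrArg constantCoeff (pderiv_comm a b _)
  have ht' (a b c : Fin 3) : t a b c = t a c b := by
    simp only [t, pderiv_comm b c]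
  refine det_symmetric_tensor_ne_sum_two_cubes
    (fun k i j => ∑ a, ∑ b, ∑ c, B⁻¹ a k * B⁻¹ b i * B⁻¹ c j * t a b c) ?_ ?_ hA fun v => ?_
  · intro i j k
    rw [Finset.sum_comm]
    refine Finset.sum_congr rfl fun a _ => Finset.sum_congr rfl fun b _ =>
      Finset.sum_congr rfl fun c _ => ?_
    rw [ht b a c]
    ring
  · intro i j k
    refine Finset.sum_congr rfl fun a _ => ?_
    rw [Finset.sum_comm]
    refine Finset.sum_congr rfl fun b _ => Finset.sum_congr rfl fun c _ => ?_
    rw [ht' a c b]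
    ring
  · rw [det_tensor_change_of_basis, ← eval_hess hg, hf, map_add, map_pow, map_pow, hpv, hqv]
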